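/- Let f be a matrix polynomial of degree 2m+1 with det A_0 ≠ 0, and suppose Hermitian q×q matrices s_0, ..., s_{2m} are Markov parameters of f. Then f is a Hurwitz-type matrix (HTM) polynomial if and only if the block Hankel matrices H_{1,m} = (s_{i+j})_{i,j=0}^{m} and H_{2,m-1} = (s_{i+j+1})_{i,j=0}^{m-1} are both positive definite. -/

import Mathlib

open Matrix MeasureTheory
open scoped ComplexOrder

noncomputable section

/-- The space of `q × q` complex matrices. -/
abbrev Mat (q : ℕ) := Matrix (Fin q) (Fin q) ℂ

/-- The h-part of an even-degree matrix polynomial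
`f(z) = A 0 * z^(2m) + ... + A (2m)`:  `h(z) = A 0 * z^m + A 2 * z^(m-1) + ... + A (2m)`. -/
def hEven (q m : ℕ) (A : ℕ → Mat q) (z : ℂ) : Mat q :=
  ∑ j ∈ Finset.range (m + 1), z ^ (m - j) • A (2 * j)

/-- The g-part of an even-degree matrix polynomial:
`g(z) = A 1 * z^(m-1) + A 3 * z^(m-2) + ... + A (2m-1)`. -/
def gEven (q m : ℕ) (A : ℕ → Mat q) (z : ℂ) : Mat q :=
  ∑ j ∈ Finset.range m, z ^ (m - 1 - j) • A (2 * j + 1)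

/-- The h-part of an odd-degree matrix polynomial
`f(z) = A 0 * z^(2m+1) + ... + A (2m+1)`:  `h(z) = A 1 * z^m + ... + A (2m+1)`. -/
def hOdd (q m : ℕ) (A : ℕ → Mat q) (z : ℂ) : Mat q :=
  ∑ j ∈ Finset.range (m + 1), z ^ (m - j) • A (2 * j + 1)

/-- The g-part of an odd-degree matrix polynomial: `g(z) = A 0 * z^m + ... + A (2m)`. -/
def gOdd (q m : ℕ) (A : ℕ → Mat q) (z : ℂ) : Mat q :=
  ∑ j ∈ Finset.range (m + 1), z ^ (m - j) • A (2 * j)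

/-- The matrix polynomial `f(z) = A 0 * z^n + A 1 * z^(n-1) + ... + A n`. -/
def fPoly (q n : ℕ) (A : ℕ → Mat q) (z : ℂ) : Mat q :=
  ∑ j ∈ Finset.range (n + 1), z ^ (n - j) • A j

/-- Continued fraction for the even case:  `wEven q m c d j z = w_{m-1-j}(z)`, where
`w_{m-1}(z) = z c_{m-1} + d_{m-1}⁻¹` and `w_k(z) = z c_k + (d_k + w_{k+1}(z)⁻¹)⁻¹`. -/
def wEven (q m : ℕ) (c d : ℕ → Mat q) : ℕ → ℂ → Mat q
  | 0, z => z • c (m - 1) + (d (m - 1))⁻¹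
  | j + 1, z => z • c (m - 2 - j) + (d (m - 2 - j) + (wEven q m c d j z)⁻¹)⁻¹

/-- Continued fraction for the odd case:  `wOdd q m c d j z = w_{m-1-j}(z)`, where
`w_{m-1}(z) = z c_{m-1} + (d_{m-1} + z⁻¹ c_m⁻¹)⁻¹`. -/
def wOdd (q m : ℕ) (c d : ℕ → Mat q) : ℕ → ℂ → Mat q
  | 0, z => z • c (m - 1) + (d (m - 1) + z⁻¹ • (c m)⁻¹)⁻¹
  | j + 1, z => z • c (m - 2 - j) + (d (m - 2 - j) + (wOdd q m c d j z)⁻¹)⁻¹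

/-- A Hurwitz-type matrix polynomial of degree 2m, described through its h-part and g-part:
there are Hermitian positive definite matrices `c_0, ..., c_{m-1}`, `d_0, ..., d_{m-1}` with
`g(z) h(z)⁻¹ = w_0(z)⁻¹` whenever `det (h z) ≠ 0` and all inverses in the recursion exist. -/
def IsHTMEven (q m : ℕ) (h g : ℂ → Mat q) : Prop :=
  ∃ c d : ℕ → Mat q,
    (∀ k < m, (c k).PosDef) ∧ (∀ k < m, (d k).PosDef) ∧
    ∀ z : ℂ, (h z).det ≠ 0 →
      (∀ j < m, IsUnit (wEven q m c d j z).det) →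
      (∀ j, j + 1 < m → IsUnit (d (m - 2 - j) + (wEven q m c d j z)⁻¹).det) →
      g z * (h z)⁻¹ = (wEven q m c d (m - 1) z)⁻¹

/-- A Hurwitz-type matrix polynomial of degree 2m+1, described through its h-part and g-part:
there are Hermitian positive definite matrices `c_0, ..., c_m`, `d_0, ..., d_{m-1}` with
`h(z) (z g(z))⁻¹ = w_0(z)⁻¹` whenever `z ≠ 0`, `det (g z) ≠ 0` and all inverses exist. -/
def IsHTMOdd (q m : ℕ) (h g : ℂ → Mat q) : Prop :=
  ∃ c d : ℕ → Mat q,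
    (∀ k ≤ m, (c k).PosDef) ∧ (∀ k < m, (d k).PosDef) ∧
    ∀ z : ℂ, z ≠ 0 → (g z).det ≠ 0 →
      IsUnit (d (m - 1) + z⁻¹ • (c m)⁻¹).det →
      (∀ j < m, IsUnit (wOdd q m c d j z).det) →
      (∀ j, j + 1 < m → IsUnit (d (m - 2 - j) + (wOdd q m c d j z)⁻¹).det) →
      h z * (z • g z)⁻¹ = (wOdd q m c d (m - 1) z)⁻¹

/-- `s_0, ..., s_{2m-1}` are Markov parameters of the even-degree polynomial with
coefficients `A`:  `z^(2m) g(z) - (∑_{j<2m} (-1)^j s_j z^(2m-1-j)) h(z)` has degree ≤ m-1. -/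
def MarkovEven (q m : ℕ) (A s : ℕ → Mat q) : Prop :=
  ∃ B : ℕ → Mat q, ∀ z : ℂ,
    z ^ (2 * m) • gEven q m A z
      - (∑ j ∈ Finset.range (2 * m), ((-1 : ℂ) ^ j * z ^ (2 * m - 1 - j)) • s j) * hEven q m A z
    = ∑ k ∈ Finset.range m, z ^ k • B k

/-- `s_0, ..., s_{2m}` are Markov parameters of the odd-degree polynomial with coefficients
`A`:  `z^(2m+1) h(z) - (∑_{j≤2m} (-1)^j s_j z^(2m-j)) z g(z)` has degree ≤ m. -/
def MarkovOdd (q m : ℕ) (A s : ℕ → Mat q) : Prop :=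
  ∃ B : ℕ → Mat q, ∀ z : ℂ,
    z ^ (2 * m + 1) • hOdd q m A z
      - (∑ j ∈ Finset.range (2 * m + 1), ((-1 : ℂ) ^ j * z ^ (2 * m - j)) • s j) *
          (z • gOdd q m A z)
    = ∑ k ∈ Finset.range (m + 1), z ^ k • B k

/-- The block Hankel matrix `H_{1,n-1} = (s_{i+j})_{i,j=0}^{n-1}` with `n` block rows. -/
def H1b (q : ℕ) (s : ℕ → Mat q) (n : ℕ) : Matrix (Fin n × Fin q) (Fin n × Fin q) ℂ :=
  Matrix.of fun p r => s ((p.1 : ℕ) + (r.1 : ℕ)) p.2 r.2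

/-- The block Hankel matrix `H_{2,n-1} = (s_{i+j+1})_{i,j=0}^{n-1}` with `n` block rows. -/
def H2b (q : ℕ) (s : ℕ → Mat q) (n : ℕ) : Matrix (Fin n × Fin q) (Fin n × Fin q) ℂ :=
  Matrix.of fun p r => s ((p.1 : ℕ) + (r.1 : ℕ) + 1) p.2 r.2

/-- The block column `Y_{1,n} = (s_n; s_{n+1}; ...; s_{2n-1})`. -/
def Y1b (q : ℕ) (s : ℕ → Mat q) (n : ℕ) : Matrix (Fin n × Fin q) (Fin q) ℂ :=
  Matrix.of fun p b => s (n + (p.1 : ℕ)) p.2 b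

/-- The block column `Y_{2,n} = (s_{n+1}; ...; s_{2n})`. -/
def Y2b (q : ℕ) (s : ℕ → Mat q) (n : ℕ) : Matrix (Fin n × Fin q) (Fin q) ℂ :=
  Matrix.of fun p b => s (n + 1 + (p.1 : ℕ)) p.2 b

/-- The block column `col (I, z I, ..., z^(n-1) I)`. -/
def colPow (q n : ℕ) (z : ℂ) : Matrix (Fin n × Fin q) (Fin q) ℂ :=
  Matrix.of fun p b => z ^ (p.1 : ℕ) * (if p.2 = b then 1 else 0)

/-- `r_i(z) = ∑_{k=1}^{i} z^(i-k) s_{k-1}`. -/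
def rPol (q : ℕ) (s : ℕ → Mat q) (i : ℕ) (z : ℂ) : Mat q :=
  ∑ k ∈ Finset.range i, z ^ (i - 1 - k) • s k

/-- `t_i(z) = ∑_{k=0}^{i} z^(i-k) s_k`. -/
def tPol (q : ℕ) (s : ℕ → Mat q) (i : ℕ) (z : ℂ) : Mat q :=
  ∑ k ∈ Finset.range (i + 1), z ^ (i - k) • s k

/-- The block column `col (r_0(z), ..., r_{n-1}(z))`. -/
def colR (q : ℕ) (s : ℕ → Mat q) (n : ℕ) (z : ℂ) : Matrix (Fin n × Fin q) (Fin q) ℂ :=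
  Matrix.of fun p b => rPol q s (p.1 : ℕ) z p.2 b

/-- The block column `col (t_0(z), ..., t_{n-1}(z))`. -/
def colT (q : ℕ) (s : ℕ → Mat q) (n : ℕ) (z : ℂ) : Matrix (Fin n × Fin q) (Fin q) ℂ :=
  Matrix.of fun p b => tPol q s (p.1 : ℕ) z p.2 b

/-- `P_{1,j}(z) = z^j I - Y_{1,j}^* H_{1,j-1}⁻¹ col(I, zI, ..., z^(j-1) I)`. -/
def P1 (q : ℕ) (s : ℕ → Mat q) (j : ℕ) (z : ℂ) : Mat q :=
  z ^ j • (1 : Mat q) - (Y1b q s j)ᴴ * (H1b q s j)⁻¹ * colPow q j z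

/-- `P_{2,j}(z) = z^j I - Y_{2,j}^* H_{2,j-1}⁻¹ col(I, zI, ..., z^(j-1) I)`. -/
def P2 (q : ℕ) (s : ℕ → Mat q) (j : ℕ) (z : ℂ) : Mat q :=
  z ^ j • (1 : Mat q) - (Y2b q s j)ᴴ * (H2b q s j)⁻¹ * colPow q j z

/-- `Q_{1,j}(z) = r_j(z) - Y_{1,j}^* H_{1,j-1}⁻¹ col(r_0(z), ..., r_{j-1}(z))`. -/
def Q1 (q : ℕ) (s : ℕ → Mat q) (j : ℕ) (z : ℂ) : Mat q :=
  rPol q s j z - (Y1b q s j)ᴴ * (H1b q s j)⁻¹ * colR q s j z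

/-- `Q_{2,j}(z) = t_j(z) - Y_{2,j}^* H_{2,j-1}⁻¹ col(t_0(z), ..., t_{j-1}(z))`. -/
def Q2 (q : ℕ) (s : ℕ → Mat q) (j : ℕ) (z : ℂ) : Mat q :=
  tPol q s j z - (Y2b q s j)ᴴ * (H2b q s j)⁻¹ * colT q s j z

/-- The block column `e = (I; 0; ...; 0)` with `n` blocks. -/
def eCol (q n : ℕ) : Matrix (Fin n × Fin q) (Fin q) ℂ :=
  Matrix.of fun p b => if (p.1 : ℕ) = 0 then (if p.2 = b then 1 else 0) else 0

/-- The block column `y = (s_0; s_1; ...; s_{n-1})`. -/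
def yCol (q : ℕ) (s : ℕ → Mat q) (n : ℕ) : Matrix (Fin n × Fin q) (Fin q) ℂ :=
  Matrix.of fun p b => s (p.1 : ℕ) p.2 b

/-- Condition C: `A_i^* A_k = A_k^* A_i` for every odd `i` and even `k` with `i, k ≤ n`. -/
def CondC (q n : ℕ) (A : ℕ → Mat q) : Prop :=
  ∀ i k, i ≤ n → k ≤ n → i % 2 = 1 → k % 2 = 0 → (A i)ᴴ * A k = (A k)ᴴ * A i

/-- The symmetrizer: for a polynomial with (descending) coefficients `Q_0, ..., Q_{n-1}`
(read off as `Q_j = A (2j)`), the `n × n` block Hankel matrix whose `(i,k)` block is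
`A (2(n-1-i-k))` if `i + k ≤ n - 1`, and `0` otherwise. -/
def Sh (q n : ℕ) (A : ℕ → Mat q) : Matrix (Fin n × Fin q) (Fin n × Fin q) ℂ :=
  Matrix.of fun p r =>
    if (p.1 : ℕ) + (r.1 : ℕ) ≤ n - 1 then A (2 * (n - 1 - (p.1 : ℕ) - (r.1 : ℕ))) p.2 r.2
    else 0

/-- The signature matrix `J̃ = diag (I, -I, I, ..., ±I)` with `n` blocks. -/
def Jt (q n : ℕ) : Matrix (Fin n × Fin q) (Fin n × Fin q) ℂ :=
  Matrix.diagonal (fun p => (-1 : ℂ) ^ (p.1 : ℕ))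

/-- The block row `(I, x² I, ..., x^(2n-2) I)`. -/
def Rev (q n : ℕ) (x : ℂ) : Matrix (Fin q) (Fin n × Fin q) ℂ :=
  Matrix.of fun a p => x ^ (2 * (p.1 : ℕ)) * (if a = p.2 then 1 else 0)

/-- The block column `(I; y² I; ...; y^(2n-2) I)`. -/
def Cev (q n : ℕ) (y : ℂ) : Matrix (Fin n × Fin q) (Fin q) ℂ :=
  Matrix.of fun p b => y ^ (2 * (p.1 : ℕ)) * (if p.2 = b then 1 else 0)

/-- The block row `(x I, x³ I, ..., x^(2n-1) I)`. -/
def Rod (q n : ℕ) (x : ℂ) : Matrix (Fin q) (Fin n × Fin q) ℂ :=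
  Matrix.of fun a p => x ^ (2 * (p.1 : ℕ) + 1) * (if a = p.2 then 1 else 0)

/-- The block column `(y I; y³ I; ...; y^(2n-1) I)`. -/
def Cod (q n : ℕ) (y : ℂ) : Matrix (Fin n × Fin q) (Fin q) ℂ :=
  Matrix.of fun p b => y ^ (2 * (p.1 : ℕ) + 1) * (if p.2 = b then 1 else 0)

section Hankel

open Finset

variable {R : Type*} [Ring R]

/-- Splitting off a block row and column from the convolved Hankel kernel. -/
theorem hankel_kernel_succ_left {s t : ℕ → R} {a : R}
    (ha : ∀ j, ∑ l ∈ range (j + 1), t l * s (j - l) = a * s (j + 1)) (i j : ℕ) :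
    ∑ k ∈ range (i + 2), ∑ l ∈ range (j + 1), s (i + 1 - k) * t (k + l) * s (j - l) =
      s (i + 1) * a * s (j + 1) +
        ∑ k ∈ range (i + 1), ∑ l ∈ range (j + 1), s (i - k) * t (k + l + 1) * s (j - l) := by
  rw [sum_range_succ', add_comm]
  congr 1
  · simp [mul_assoc, ← mul_sum, ha]
  · refine sum_congr rfl fun k _ => sum_congr rfl fun l _ => ?_
    rw [Nat.add_sub_add_right, add_right_comm]

theorem hankel_kernel_succ_right {s t : ℕ → R} {a : R}
    (ha : ∀ i, ∑ k ∈ range (i + 1), s (i - k) * t k = s (i + 1) * a) (i j : ℕ) :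
    ∑ k ∈ range (i + 1), ∑ l ∈ range (j + 2), s (i - k) * t (k + l) * s (j + 1 - l) =
      s (i + 1) * a * s (j + 1) +
        ∑ k ∈ range (i + 1), ∑ l ∈ range (j + 1), s (i - k) * t (k + l + 1) * s (j - l) := by
  simp_rw [sum_range_succ' _ (j + 1)]
  rw [sum_add_distrib, add_comm]
  congr 1
  · simp [← sum_mul, ha]
  · refine sum_congr rfl fun k _ => sum_congr rfl fun l _ => ?_
    rw [Nat.add_sub_add_right, ← add_assoc]

/-- The kernel identity `(φ(x) - φ(y)) / (x - y) = φ(x) ((xψ(x) - yψ(y)) / (x - y)) φ(y)` for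
`φ = (a - xψ)⁻¹`, in terms of coefficients. -/
theorem hankel_kernel {s t : ℕ → R} {a : R}
    (hl : ∀ i, ∑ k ∈ range (i + 1), s (i - k) * t k = s (i + 1) * a)
    (hr : ∀ j, ∑ l ∈ range (j + 1), t l * s (j - l) = a * s (j + 1))
    (h0 : a * s 0 = 1) (i j : ℕ) :
    ∑ k ∈ range (i + 1), ∑ l ∈ range (j + 1), s (i - k) * t (k + l) * s (j - l) =
      s (i + j + 1) := by
  induction j generalizing i with
  | zero =>
    simp only [zero_add, sum_range_one, add_zero, Nat.sub_self, ← sum_mul, hl]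
    rw [mul_assoc, h0, mul_one]
  | succ j ih =>
    rw [hankel_kernel_succ_right hl, ← hankel_kernel_succ_left hr, ih]
    congr 1
    ring

theorem sum_fin_ite_le {n : ℕ} (i : Fin n) (f : ℕ → R) :
    ∑ k : Fin n, (if (k : ℕ) ≤ i then f k else 0) = ∑ k ∈ range (i + 1), f k := by
  have h := Fin.sum_univ_eq_sum_range (fun k => if k ≤ (i : ℕ) then f k else 0) n
  rw [h, ← sum_filter]
  refine sum_congr ?_ fun _ _ => rfl
  ext k
  simp only [mem_filter, mem_range]
  omega

/-- The lower triangular Toeplitz matrix of a power series. -/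
def toeplitz (n : ℕ) (f : PowerSeries R) : Matrix (Fin n) (Fin n) R :=
  Matrix.of fun i k => if (k : ℕ) ≤ i then PowerSeries.coeff (i - k : ℕ) f else 0

theorem toeplitz_one (n : ℕ) : toeplitz n (1 : PowerSeries R) = 1 := by
  ext i k
  simp only [toeplitz, Matrix.of_apply, PowerSeries.coeff_one, Matrix.one_apply]
  split_ifs <;> first | rfl | (exfalso; omega)

theorem toeplitz_mul (n : ℕ) (f g : PowerSeries R) :
    toeplitz n (f * g) = toeplitz n f * toeplitz n g := by
  ext i k
  simp only [toeplitz, Matrix.of_apply, Matrix.mul_apply, ite_mul, zero_mul]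
  rw [sum_fin_ite_le i (fun l => PowerSeries.coeff (i - l : ℕ) f *
    (if (k : ℕ) ≤ l then PowerSeries.coeff (l - k : ℕ) g else 0))]
  split_ifs with h
  · rw [PowerSeries.coeff_mul, ← Finset.Nat.sum_antidiagonal_swap,
      Finset.Nat.sum_antidiagonal_eq_sum_range_succ_mk]
    rw [← sum_range_add_sum_Ico _ (show (k : ℕ) ≤ i + 1 by omega), sum_Ico_eq_sum_range,
      sum_eq_zero (s := range (k : ℕ)), zero_add, show (i : ℕ) + 1 - k = i - k + 1 by omega]
    · refine sum_congr rfl fun l hl => ?_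
      have := mem_range.1 hl
      simp only [Prod.swap]
      rw [if_pos (by omega), Nat.add_sub_cancel_left, Nat.sub_sub]
    · intro l hl
      rw [if_neg (by have := mem_range.1 hl; omega), mul_zero]
  · refine (sum_eq_zero fun l hl => ?_).symm
    have := mem_range.1 hl
    rw [if_neg (by omega), mul_zero]

theorem isUnit_toeplitz (n : ℕ) {f : PowerSeries R} (hf : IsUnit f) : IsUnit (toeplitz n f) := by
  obtain ⟨u, rfl⟩ := hf
  exact ⟨⟨toeplitz n u, toeplitz n ↑u⁻¹, by rw [← toeplitz_mul, u.mul_inv, toeplitz_one],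
    by rw [← toeplitz_mul, u.inv_mul, toeplitz_one]⟩, rfl⟩

/-- A lower-triangular Toeplitz congruence, entrywise. -/
theorem toeplitz_mul_mul_star_apply [StarRing R] {n : ℕ} {f : PowerSeries R}
    (hf : ∀ i < n, star (PowerSeries.coeff i f) = PowerSeries.coeff i f)
    (M : ℕ → ℕ → R) (i j : Fin n) :
    (toeplitz n f * (Matrix.of fun k l : Fin n => M k l) * star (toeplitz n f)) i j =
      ∑ k ∈ range (i + 1), ∑ l ∈ range (j + 1),
        PowerSeries.coeff (i - k : ℕ) f * M k l * PowerSeries.coeff (j - l : ℕ) f := by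
  simp only [Matrix.mul_apply, Matrix.star_apply, toeplitz, Matrix.of_apply, sum_mul]
  rw [sum_comm, ← sum_fin_ite_le]
  refine sum_congr rfl fun k _ => ?_
  split_ifs
  · rw [← sum_fin_ite_le]
    refine sum_congr rfl fun l _ => ?_
    split_ifs
    · rw [hf _ (by omega)]
    · simp
  · simp

variable {φ ψ : PowerSeries R} {a : R}

theorem sum_mul_coeff_of_mul_eq_one (h : φ * (PowerSeries.C a - PowerSeries.X * ψ) = 1) (i : ℕ) :
    ∑ k ∈ range (i + 1), PowerSeries.coeff (i - k) φ * PowerSeries.coeff k ψ =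
      PowerSeries.coeff (i + 1) φ * a := by
  have h' := congrArg (PowerSeries.coeff (i + 1)) h
  rw [mul_sub, ← mul_assoc, (PowerSeries.commute_X φ).eq, mul_assoc, map_sub,
    PowerSeries.coeff_succ_X_mul, PowerSeries.coeff_mul_C, PowerSeries.coeff_one,
    if_neg (Nat.succ_ne_zero i), sub_eq_zero, PowerSeries.coeff_mul,
    ← Finset.Nat.sum_antidiagonal_swap, Finset.Nat.sum_antidiagonal_eq_sum_range_succ_mk] at h'
  exact h'.symm

theorem sum_coeff_mul_of_mul_eq_one (h : (PowerSeries.C a - PowerSeries.X * ψ) * φ = 1) (i : ℕ) :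
    ∑ k ∈ range (i + 1), PowerSeries.coeff k ψ * PowerSeries.coeff (i - k) φ =
      a * PowerSeries.coeff (i + 1) φ := by
  have h' := congrArg (PowerSeries.coeff (i + 1)) h
  rw [sub_mul, mul_assoc, map_sub,
    PowerSeries.coeff_succ_X_mul, PowerSeries.coeff_C_mul, PowerSeries.coeff_one,
    if_neg (Nat.succ_ne_zero i), sub_eq_zero, PowerSeries.coeff_mul,
    Finset.Nat.sum_antidiagonal_eq_sum_range_succ_mk] at h'
  exact h'.symm

theorem mul_coeff_zero_of_mul_eq_one (h : (PowerSeries.C a - PowerSeries.X * ψ) * φ = 1) :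
    a * PowerSeries.coeff 0 φ = 1 := by
  simpa [PowerSeries.coeff_mul] using congrArg (PowerSeries.coeff 0) h

/-- The shifted Hankel matrix of `(a - xψ)⁻¹` is congruent to the Hankel matrix of `ψ`. -/
theorem toeplitz_congr_hankel [StarRing R] (n : ℕ)
    (h₁ : φ * (PowerSeries.C a - PowerSeries.X * ψ) = 1)
    (h₂ : (PowerSeries.C a - PowerSeries.X * ψ) * φ = 1)
    (hφ : ∀ i < n, star (PowerSeries.coeff i φ) = PowerSeries.coeff i φ) :
    toeplitz n φ * (Matrix.of fun k l : Fin n => PowerSeries.coeff (k + l : ℕ) ψ) *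
      star (toeplitz n φ) = Matrix.of fun k l : Fin n => PowerSeries.coeff (k + l + 1 : ℕ) φ := by
  ext i j
  rw [toeplitz_mul_mul_star_apply hφ fun k l => PowerSeries.coeff (k + l) ψ]
  exact hankel_kernel (s := fun k => PowerSeries.coeff k φ) (t := fun k => PowerSeries.coeff k ψ)
    (sum_mul_coeff_of_mul_eq_one h₁) (sum_coeff_mul_of_mul_eq_one h₂)
    (mul_coeff_zero_of_mul_eq_one h₂) i j

/-- The block diagonal kernel with corner `a` followed by the shifted Hankel kernel of `ψ`. -/
def cornerKernel (a : R) (ψ : PowerSeries R) : ℕ → ℕ → R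
  | 0, 0 => a
  | k + 1, l + 1 => PowerSeries.coeff (k + l + 1) ψ
  | _, _ => 0

/-- The Hankel matrix of `(a - xψ)⁻¹` is congruent to the direct sum of `a` and the shifted
Hankel matrix of `ψ`. -/
theorem toeplitz_congr_cornerKernel [StarRing R] (n : ℕ)
    (h₁ : φ * (PowerSeries.C a - PowerSeries.X * ψ) = 1)
    (h₂ : (PowerSeries.C a - PowerSeries.X * ψ) * φ = 1)
    (hφ : ∀ i < n, star (PowerSeries.coeff i φ) = PowerSeries.coeff i φ) :
    toeplitz n φ * (Matrix.of fun k l : Fin n => cornerKernel a ψ k l) *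
      star (toeplitz n φ) = Matrix.of fun k l : Fin n => PowerSeries.coeff (k + l : ℕ) φ := by
  have hl := sum_mul_coeff_of_mul_eq_one h₁
  have hr := sum_coeff_mul_of_mul_eq_one h₂
  have h0 := mul_coeff_zero_of_mul_eq_one h₂
  have h0' : PowerSeries.coeff 0 φ * a = 1 := by
    have h' := congrArg (PowerSeries.coeff 0) h₁
    simpa [PowerSeries.coeff_mul] using h'
  ext i j
  rw [toeplitz_mul_mul_star_apply hφ, Matrix.of_apply]
  generalize (i : ℕ) = i
  generalize (j : ℕ) = j
  rw [sum_range_succ', sum_range_succ']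
  simp only [sum_range_succ' _ j, cornerKernel, mul_zero, zero_mul, sum_const_zero, add_zero,
    zero_add, Nat.sub_zero]
  rcases i with - | i
  · rw [Finset.sum_range_zero, zero_add, h0', one_mul, zero_add]
  rcases j with - | j
  · simp only [Finset.sum_range_zero, sum_const_zero, zero_add]
    rw [mul_assoc, h0, mul_one, add_zero]
  have := hankel_kernel (s := fun k => PowerSeries.coeff k φ)
    (t := fun k => PowerSeries.coeff k ψ) hl hr h0 (i + 1) j
  rw [hankel_kernel_succ_left (s := fun k => PowerSeries.coeff k φ)
    (t := fun k => PowerSeries.coeff k ψ) hr] at this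
  rw [← add_assoc, ← this, add_comm]
  simp only [Nat.add_sub_add_right]

end Hankel

section Truncation

variable {R : Type*} [Ring R]

/-- Congruence of power series modulo `X ^ n`. -/
def TruncEq (n : ℕ) (f g : PowerSeries R) : Prop :=
  ∀ k < n, PowerSeries.coeff k f = PowerSeries.coeff k g

theorem TruncEq.symm {n : ℕ} {f g : PowerSeries R} (h : TruncEq n f g) : TruncEq n g f :=
  fun k hk => (h k hk).symm

theorem TruncEq.trans {n : ℕ} {f g h : PowerSeries R} (hfg : TruncEq n f g)
    (hgh : TruncEq n g h) : TruncEq n f h :=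
  fun k hk => (hfg k hk).trans (hgh k hk)

theorem TruncEq.mul_left {n : ℕ} {f g : PowerSeries R} (h : TruncEq n f g) (p : PowerSeries R) :
    TruncEq n (p * f) (p * g) := by
  intro k hk
  rw [PowerSeries.coeff_mul, PowerSeries.coeff_mul]
  refine Finset.sum_congr rfl fun x hx => ?_
  rw [h _ (by have := Finset.HasAntidiagonal.mem_antidiagonal.1 hx; omega)]

theorem TruncEq.mul_right {n : ℕ} {f g : PowerSeries R} (h : TruncEq n f g) (p : PowerSeries R) :
    TruncEq n (f * p) (g * p) := by
  intro k hk
  rw [PowerSeries.coeff_mul, PowerSeries.coeff_mul]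
  refine Finset.sum_congr rfl fun x hx => ?_
  rw [h _ (by have := Finset.HasAntidiagonal.mem_antidiagonal.1 hx; omega)]

theorem TruncEq.X_mul {n : ℕ} {f g : PowerSeries R} (h : TruncEq n f g) :
    TruncEq (n + 1) (PowerSeries.X * f) (PowerSeries.X * g) := by
  rintro (- | k) hk
  · simp
  · rw [PowerSeries.coeff_succ_X_mul, PowerSeries.coeff_succ_X_mul, h k (by omega)]

theorem TruncEq.const_sub {n : ℕ} {f g : PowerSeries R} (h : TruncEq n f g) (p : PowerSeries R) :
    TruncEq n (p - f) (p - g) := by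
  intro k hk
  rw [map_sub, map_sub, h k hk]

theorem TruncEq.of_mul_left {n : ℕ} {f g p : PowerSeries R} (hp : IsUnit p)
    (h : TruncEq n (p * f) (p * g)) : TruncEq n f g := by
  obtain ⟨u, rfl⟩ := hp
  simpa using h.mul_left ↑u⁻¹

theorem TruncEq.of_mul_right {n : ℕ} {f g p : PowerSeries R} (hp : IsUnit p)
    (h : TruncEq n (f * p) (g * p)) : TruncEq n f g := by
  obtain ⟨u, rfl⟩ := hp
  simpa using h.mul_right ↑u⁻¹

/-- Inversion respects congruence modulo `X ^ n`. -/
theorem TruncEq.inverse {n : ℕ} {f f' g g' : PowerSeries R} (hf : f * f' = 1) (hg : g' * g = 1)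
    (h : TruncEq n f g) : TruncEq n f' g' := by
  have := (h.mul_left g').mul_right f'
  rw [hg, mul_assoc, hf, one_mul, mul_one] at this
  exact this.symm

end Truncation

section Adjoint

variable {R : Type*} [Ring R] [StarRing R]

/-- The coefficientwise adjoint of a power series. -/
def starSeries (f : PowerSeries R) : PowerSeries R :=
  PowerSeries.mk fun n => star (PowerSeries.coeff n f)

theorem coeff_starSeries (n : ℕ) (f : PowerSeries R) :
    PowerSeries.coeff n (starSeries f) = star (PowerSeries.coeff n f) :=
  PowerSeries.coeff_mk _ _

theorem starSeries_mul (f g : PowerSeries R) :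
    starSeries (f * g) = starSeries g * starSeries f := by
  ext n
  rw [coeff_starSeries, PowerSeries.coeff_mul, PowerSeries.coeff_mul, star_sum,
    ← Finset.Nat.sum_antidiagonal_swap]
  exact Finset.sum_congr rfl fun x _ => by simp [coeff_starSeries]

theorem starSeries_one : starSeries (1 : PowerSeries R) = 1 := by
  ext n
  rw [coeff_starSeries, PowerSeries.coeff_one]
  split_ifs <;> simp

theorem truncEq_starSeries_iff_of_mul_eq_one {n : ℕ} {f g : PowerSeries R}
    (h₁ : f * g = 1) (h₂ : g * f = 1) :
    TruncEq n (starSeries f) f ↔ TruncEq n (starSeries g) g := by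
  have h₁' : starSeries g * starSeries f = 1 := by rw [← starSeries_mul, h₁, starSeries_one]
  have h₂' : starSeries f * starSeries g = 1 := by rw [← starSeries_mul, h₂, starSeries_one]
  exact ⟨fun h => h.inverse h₂' h₂, fun h => h.inverse h₁' h₁⟩

theorem truncEq_starSeries_C_sub_X_mul {n : ℕ} {a : R} {ψ : PowerSeries R} :
    TruncEq (n + 1) (starSeries (PowerSeries.C a - PowerSeries.X * ψ))
      (PowerSeries.C a - PowerSeries.X * ψ) ↔ star a = a ∧ TruncEq n (starSeries ψ) ψ := by
  constructor
  · intro h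
    refine ⟨by simpa [coeff_starSeries] using h 0 (by omega), fun k hk => ?_⟩
    have := h (k + 1) (by omega)
    simpa [coeff_starSeries, PowerSeries.coeff_succ_X_mul, PowerSeries.coeff_C] using this
  · rintro ⟨ha, h⟩ (- | k) hk
    · simpa [coeff_starSeries] using ha
    · have := h k (by omega)
      simpa [coeff_starSeries, PowerSeries.coeff_succ_X_mul, PowerSeries.coeff_C] using this

end Adjoint

section Stieltjes

variable {q : ℕ}

/-- The first `n` coefficients of `φ` are Hermitian and both of the block Hankel matrices which
they determine are positive definite. -/
def StieltjesPos (q n : ℕ) (φ : PowerSeries (Mat q)) : Prop :=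
  TruncEq n (starSeries φ) φ ∧
    (H1b q (fun j => PowerSeries.coeff j φ) ((n + 1) / 2)).PosDef ∧
    (H2b q (fun j => PowerSeries.coeff j φ) (n / 2)).PosDef

theorem StieltjesPos.congr {n : ℕ} {φ ψ : PowerSeries (Mat q)} (hφ : StieltjesPos q n φ)
    (h : TruncEq n φ ψ) : StieltjesPos q n ψ := by
  obtain ⟨h0, h1, h2⟩ := hφ
  refine ⟨fun k hk => ?_, ?_, ?_⟩
  · rw [coeff_starSeries, ← h k hk, ← coeff_starSeries, h0 k hk]
  · convert! h1 using 1
    ext p r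
    simp only [H1b, Matrix.of_apply]
    rw [h _ (by omega)]
  · convert! h2 using 1
    ext p r
    simp only [H2b, Matrix.of_apply]
    rw [h _ (by omega)]

theorem comp_star {n : ℕ} (M : Matrix (Fin n) (Fin n) (Mat q)) :
    Matrix.comp _ _ _ _ _ (star M) = star (Matrix.comp _ _ _ _ _ M) :=
  rfl

theorem posDef_comp_toeplitz_congr_iff {n : ℕ} {φ : PowerSeries (Mat q)} (hφ : IsUnit φ)
    (M : Matrix (Fin n) (Fin n) (Mat q)) :
    (Matrix.comp _ _ _ _ _ (toeplitz n φ * M * star (toeplitz n φ))).PosDef ↔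
      (Matrix.comp _ _ _ _ _ M).PosDef := by
  rw [← Matrix.compRingEquiv_apply, map_mul, map_mul]
  simp only [Matrix.compRingEquiv_apply, comp_star]
  exact Matrix.IsUnit.posDef_star_right_conjugate_iff
    ((Matrix.isUnit_comp_iff _ _ _).2 (isUnit_toeplitz n hφ))

theorem posDef_comp_cornerKernel_iff (n : ℕ) (a : Mat q) (ψ : PowerSeries (Mat q)) :
    (Matrix.comp _ _ _ _ _
      (Matrix.of fun k l : Fin (n + 1) => cornerKernel a ψ k l)).PosDef ↔
      a.PosDef ∧ (H2b q (fun j => PowerSeries.coeff j ψ) n).PosDef := by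
  constructor
  · intro h
    constructor
    · exact h.submatrix (e := fun b : Fin q => ((0 : Fin (n + 1)), b))
        (Prod.mk_right_injective 0)
    · exact h.submatrix (e := fun p : Fin n × Fin q => (p.1.succ, p.2))
        ((Fin.succ_injective n).prodMap Function.injective_id)
  · rintro ⟨ha, hH⟩
    refine Matrix.posDef_iff_dotProduct_mulVec.2 ⟨?_, fun x hx => ?_⟩
    · ext ⟨k, b⟩ ⟨l, c⟩
      refine Fin.cases ?_ (fun k => ?_) k <;> refine Fin.cases ?_ (fun l => ?_) l
      · exact ha.isHermitian.apply b c
      · simp [Matrix.conjTranspose_apply, Matrix.comp_apply, cornerKernel]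
      · simp [Matrix.conjTranspose_apply, Matrix.comp_apply, cornerKernel]
      · exact hH.isHermitian.apply (k, b) (l, c)
    · set y : Fin q → ℂ := fun b => x (0, b)
      set w : Fin n × Fin q → ℂ := fun p => x (p.1.succ, p.2)
      have key : star x ⬝ᵥ (Matrix.comp _ _ _ _ _
          (Matrix.of fun k l : Fin (n + 1) => cornerKernel a ψ k l)) *ᵥ x =
          star y ⬝ᵥ a *ᵥ y +
            star w ⬝ᵥ H2b q (fun j => PowerSeries.coeff j ψ) n *ᵥ w := by
        simp [dotProduct, mulVec, Fintype.sum_prod_type, Fin.sum_univ_succ, Matrix.comp_apply,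
          cornerKernel, H2b, y, w]
      rw [key]
      by_cases hy : y = 0
      · have hw : w ≠ 0 := by
          rintro hw
          apply hx
          ext ⟨k, b⟩
          refine Fin.cases ?_ (fun k => ?_) k
          · exact congrFun hy b
          · exact congrFun hw (k, b)
        exact add_pos_of_nonneg_of_pos (ha.posSemidef.dotProduct_mulVec_nonneg y)
          (hH.dotProduct_mulVec_pos hw)
      · exact add_pos_of_pos_of_nonneg (ha.dotProduct_mulVec_pos hy)
          (hH.posSemidef.dotProduct_mulVec_nonneg w)

/-- One step of the continued fraction expansion preserves positivity. -/
theorem stieltjesPos_succ_iff {n : ℕ} {a : Mat q} {φ ψ : PowerSeries (Mat q)}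
    (h₁ : φ * (PowerSeries.C a - PowerSeries.X * ψ) = 1)
    (h₂ : (PowerSeries.C a - PowerSeries.X * ψ) * φ = 1) :
    StieltjesPos q (n + 1) φ ↔ a.PosDef ∧ StieltjesPos q n ψ := by
  have hstar := (truncEq_starSeries_iff_of_mul_eq_one (n := n + 1) h₁ h₂).trans
    (truncEq_starSeries_C_sub_X_mul (R := Mat q) (a := a) (ψ := ψ))
  by_cases hφ : TruncEq (n + 1) (starSeries φ) φ
  · have hφ' : ∀ k < n + 1, star (PowerSeries.coeff k φ) = PowerSeries.coeff k φ :=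
      fun k hk => by rw [← coeff_starSeries, hφ k hk]
    have hu : IsUnit φ := ⟨⟨φ, _, h₁, h₂⟩, rfl⟩
    have e1 := posDef_comp_toeplitz_congr_iff hu
      (Matrix.of fun k l : Fin (n / 2 + 1) => cornerKernel a ψ k l)
    rw [toeplitz_congr_cornerKernel _ h₁ h₂ fun k hk => hφ' k (by omega),
      posDef_comp_cornerKernel_iff] at e1
    have e2 := posDef_comp_toeplitz_congr_iff hu
      (Matrix.of fun k l : Fin ((n + 1) / 2) => PowerSeries.coeff (k + l : ℕ) ψ)
    rw [toeplitz_congr_hankel _ h₁ h₂ fun k hk => hφ' k (by omega)] at e2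
    have hn : (n + 1 + 1) / 2 = n / 2 + 1 := by omega
    unfold StieltjesPos
    rw [hn]
    have := hstar.1 hφ
    constructor
    · rintro ⟨-, h, h'⟩
      exact ⟨(e1.1 h).1, this.2, e2.1 h', (e1.1 h).2⟩
    · rintro ⟨ha, -, h, h'⟩
      exact ⟨hφ, e1.2 ⟨ha, h'⟩, e2.2 h⟩
  · refine iff_of_false (fun h => hφ h.1) fun h => hφ (hstar.2 ⟨h.1.isHermitian, h.2.1⟩)

end Stieltjes

section Convergents

open Polynomial

variable {R : Type*} [Ring R]

/-- The (left) denominators of the convergents of a continued fraction with partial denominators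
`b 0, b 1, ...`, counted from the innermost one. -/
def convDen (b : ℕ → R) : ℕ → R[X]
  | 0 => 0
  | 1 => 1
  | n + 2 => convDen b (n + 1) * C (b n) - X * convDen b n

theorem convDen_congr {b b' : ℕ → R} {n : ℕ} (h : ∀ j, j + 1 < n → b j = b' j) :
    convDen b n = convDen b' n := by
  induction n using Nat.twoStepInduction with
  | zero => rfl
  | one => rfl
  | more n ih₁ ih₂ =>
    rw [convDen, convDen, ih₁ fun j hj => h j (by omega), ih₂ fun j hj => h j (by omega),
      h n (by omega)]

theorem natDegree_convDen_le (b : ℕ → R) (j : ℕ) :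
    (convDen b (2 * j + 1)).natDegree ≤ j ∧ (convDen b (2 * j + 2)).natDegree ≤ j := by
  have step : ∀ n k l : ℕ, (convDen b n).natDegree + 1 ≤ l → (convDen b (n + 1)).natDegree ≤ k →
      k ≤ l → (convDen b (n + 2)).natDegree ≤ l := by
    intro n k l h₁ h₂ hkl
    change (convDen b (n + 1) * C (b n) - X * convDen b n).natDegree ≤ l
    refine (natDegree_sub_le _ _).trans (max_le ?_ ?_)
    · exact (natDegree_mul_C_le _ _).trans (h₂.trans hkl)
    · refine natDegree_mul_le.trans ?_
      have := natDegree_X_le (R := R)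
      omega
  induction j with
  | zero =>
    refine ⟨by simp [convDen], ?_⟩
    simp [convDen]
  | succ j ih =>
    have h3 : (convDen b (2 * j + 3)).natDegree ≤ j + 1 :=
      step (2 * j + 1) j (j + 1) (by omega) ih.2 (by omega)
    exact ⟨h3, step (2 * j + 2) (j + 1) (j + 1) (by omega) h3 le_rfl⟩

theorem coe_convDen_succ_succ (b : ℕ → R) (n : ℕ) :
    (convDen b (n + 2) : PowerSeries R) =
      ((convDen b (n + 1) : R[X]) : PowerSeries R) * PowerSeries.C (b n) -
        PowerSeries.X * ((convDen b n : R[X]) : PowerSeries R) := by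
  rw [show convDen b (n + 2) = convDen b (n + 1) * C (b n) - X * convDen b n from rfl,
    ← coeToPowerSeries.ringHom_apply, map_sub, map_mul, map_mul]
  simp only [coeToPowerSeries.ringHom_apply, Polynomial.coe_C, Polynomial.coe_X]

/-- Evaluation of a polynomial with matrix coefficients at a scalar. -/
def scalarEval {q : ℕ} (x : ℂ) : (Mat q)[X] →+* Mat q :=
  eval₂RingHom' (RingHom.id _) (algebraMap ℂ (Mat q) x) fun a => (Algebra.commutes x a).symm

variable {q : ℕ}

theorem scalarEval_C (x : ℂ) (a : Mat q) : scalarEval x (C a) = a :=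
  eval₂_C _ _

theorem scalarEval_X (x : ℂ) : scalarEval x (X : (Mat q)[X]) = algebraMap ℂ (Mat q) x :=
  eval₂_X _ _

theorem scalarEval_X_pow_mul (x : ℂ) (k : ℕ) (p : (Mat q)[X]) :
    scalarEval x (X ^ k * p) = x ^ k • scalarEval x p := by
  rw [map_mul, map_pow, scalarEval_X, ← map_pow, Algebra.smul_def]

theorem scalarEval_eq_sum (x : ℂ) (p : (Mat q)[X]) :
    scalarEval x p = ∑ k ∈ Finset.range (p.natDegree + 1), x ^ k • p.coeff k := by
  conv_lhs => rw [p.as_sum_range_C_mul_X_pow, map_sum]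
  refine Finset.sum_congr rfl fun k _ => ?_
  rw [(Polynomial.commute_X_pow _ k).symm.eq, scalarEval_X_pow_mul, scalarEval_C]

theorem continuous_scalarEval (p : (Mat q)[X]) : Continuous fun x => scalarEval x p := by
  simp_rw [scalarEval_eq_sum]
  fun_prop

theorem eq_zero_of_infinite_scalarEval {p : (Mat q)[X]}
    (h : {x | scalarEval x p = 0}.Infinite) : p = 0 := by
  ext k i j
  by_cases hk : k < p.natDegree + 1
  swap
  · rw [coeff_eq_zero_of_natDegree_lt (by omega), coeff_zero]
  set P : ℂ[X] := ∑ k ∈ Finset.range (p.natDegree + 1), monomial k (p.coeff k i j) with hP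
  have hP0 : P = 0 := by
    refine eq_zero_of_infinite_isRoot P (h.mono fun x hx => ?_)
    have hx' : scalarEval x p = 0 := hx
    rw [scalarEval_eq_sum] at hx'
    have := congrFun (congrFun hx' i) j
    rw [Matrix.sum_apply] at this
    simp only [Set.mem_ofPred_eq, IsRoot, hP, eval_finsetSum, eval_monomial]
    rw [← Matrix.zero_apply (α := ℂ) i j, ← this]
    exact Finset.sum_congr rfl fun k _ => mul_comm _ _
  have := congrArg (fun r => coeff r k) hP0
  simpa [hP, coeff_monomial, Nat.lt_succ_iff.1 hk] using this

theorem eq_of_infinite_scalarEval {p r : (Mat q)[X]}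
    (h : {x | scalarEval x p = scalarEval x r}.Infinite) : p = r := by
  refine sub_eq_zero.1 (eq_zero_of_infinite_scalarEval (h.mono fun x hx => ?_))
  rw [Set.mem_ofPred_eq, map_sub, sub_eq_zero]
  exact hx

theorem scalarEval_convDen (b : ℕ → Mat q) (x : ℂ) (n : ℕ) :
    scalarEval x (convDen b (n + 2)) =
      scalarEval x (convDen b (n + 1)) * b n - x • scalarEval x (convDen b n) := by
  rw [convDen, map_sub, map_mul, scalarEval_C, ← pow_one (X : (Mat q)[X]), scalarEval_X_pow_mul,
    pow_one]

theorem isUnit_scalarEval_zero_convDen {b : ℕ → Mat q} {n : ℕ} (hb : ∀ j < n, IsUnit (b j)) :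
    IsUnit (scalarEval 0 (convDen b (n + 1))) := by
  induction n with
  | zero => simp [convDen]
  | succ n ih =>
    rw [scalarEval_convDen, zero_smul, sub_zero]
    exact (ih fun j hj => hb j (by omega)).mul (hb n (by omega))

theorem isUnit_coe_of_isUnit_scalarEval_zero {p : (Mat q)[X]} (h : IsUnit (scalarEval 0 p)) :
    IsUnit (p : PowerSeries (Mat q)) := by
  rw [PowerSeries.isUnit_iff_constantCoeff, Polynomial.constantCoeff_coe]
  rw [scalarEval_eq_sum, Finset.sum_range_succ'] at h
  simpa using h

theorem posDef_of_isEmpty {ι : Type*} [h : IsEmpty ι] (M : Matrix ι ι ℂ) : M.PosDef :=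
  ⟨Subsingleton.elim _ _, fun x hx => absurd (Subsingleton.elim x 0) hx⟩

/-- A continued fraction with positive definite partial denominators has positive moments. -/
theorem exists_stieltjesPos_of_posDef {b : ℕ → Mat q} {n : ℕ} (hb : ∀ j < n, (b j).PosDef) :
    ∃ φ : PowerSeries (Mat q), StieltjesPos q n φ ∧
      (convDen b (n + 1) : PowerSeries (Mat q)) * φ = convDen b n := by
  induction n with
  | zero =>
    refine ⟨0, ⟨fun k hk => absurd hk (by omega), ?_, ?_⟩, by simp [convDen]⟩
    · exact posDef_of_isEmpty (h := ⟨fun p => p.1.elim0⟩) _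
    · exact posDef_of_isEmpty (h := ⟨fun p => p.1.elim0⟩) _
  | succ n ih =>
    obtain ⟨ψ, hψ, hden⟩ := ih fun j hj => hb j (by omega)
    have hu : IsUnit (PowerSeries.C (b n) - PowerSeries.X * ψ) := by
      rw [PowerSeries.isUnit_iff_constantCoeff]
      simpa using (hb n (by omega)).isUnit
    obtain ⟨u, hu⟩ := hu
    refine ⟨↑u⁻¹, (stieltjesPos_succ_iff (a := b n) (ψ := ψ) ?_ ?_).2 ⟨hb n (by omega), hψ⟩, ?_⟩
    · rw [← hu, u.inv_mul]
    · rw [← hu, u.mul_inv]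
    · rw [coe_convDen_succ_succ, ← hden, ← mul_assoc PowerSeries.X _ ψ,
        ← (PowerSeries.commute_X _).eq, mul_assoc _ PowerSeries.X, ← mul_sub, ← hu, mul_assoc,
        u.mul_inv, mul_one]

/-- Positive moments admit a continued fraction expansion with positive definite partial
denominators. -/
theorem StieltjesPos.exists_posDef {n : ℕ} {φ : PowerSeries (Mat q)} (hφ : StieltjesPos q n φ) :
    ∃ b : ℕ → Mat q, (∀ j < n, (b j).PosDef) ∧
      TruncEq n (((convDen b (n + 1) : (Mat q)[X]) : PowerSeries (Mat q)) * φ) (convDen b n) := by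
  induction n generalizing φ with
  | zero => exact ⟨0, fun j hj => absurd hj (by omega), fun j hj => absurd hj (by omega)⟩
  | succ n ih =>
    have h0 : (PowerSeries.coeff 0 φ).PosDef :=
      hφ.2.1.submatrix (e := fun b : Fin q => ((⟨0, by omega⟩ : Fin ((n + 1 + 1) / 2)), b))
        (Prod.mk_right_injective _)
    have hu : IsUnit φ := by
      rw [PowerSeries.isUnit_iff_constantCoeff]
      simpa using h0.isUnit
    obtain ⟨u, rfl⟩ := hu
    set a := PowerSeries.coeff 0 (↑u⁻¹ : PowerSeries (Mat q)) with ha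
    set ψ : PowerSeries (Mat q) := -PowerSeries.mk fun k => PowerSeries.coeff (k + 1) ↑u⁻¹
    have hψ : (↑u⁻¹ : PowerSeries (Mat q)) = PowerSeries.C a - PowerSeries.X * ψ := by
      ext1 k
      rcases k with - | k
      · simp [ha]
      · simp [ψ, PowerSeries.coeff_succ_X_mul]
    obtain ⟨hapos, hψpos⟩ := (stieltjesPos_succ_iff (a := a) (ψ := ψ)
      (by rw [← hψ, u.mul_inv]) (by rw [← hψ, u.inv_mul])).1 hφ
    obtain ⟨b, hb, hden⟩ := ih hψpos
    have hc : ∀ k ≤ n + 1, convDen (Function.update b n a) k = convDen b k := fun k hk =>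
      convDen_congr fun j hj => Function.update_of_ne (by omega) _ _
    refine ⟨Function.update b n a, fun j hj => ?_, ?_⟩
    · rcases eq_or_ne j n with rfl | hjn
      · simpa using hapos
      · rw [Function.update_of_ne hjn]
        exact hb j (by omega)
    · rw [coe_convDen_succ_succ, hc _ le_rfl, hc _ (by omega), Function.update_self]
      have := (hden.symm.X_mul.const_sub
        (((convDen b (n + 1) : (Mat q)[X]) : PowerSeries (Mat q)) * PowerSeries.C a)).mul_right ↑u
      rwa [← mul_assoc PowerSeries.X _ ψ,
        ← (PowerSeries.commute_X ((convDen b (n + 1) : (Mat q)[X]) : PowerSeries (Mat q))).eq,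
        mul_assoc _ PowerSeries.X,
        ← mul_sub, ← hψ, mul_assoc _ (↑u⁻¹ : PowerSeries (Mat q)), u.inv_mul, mul_one] at this

end Convergents

section ContinuedFraction

variable {q m : ℕ} {b c d r : ℕ → Mat q} {z : ℂ}

theorem inv_smul_of_ne_zero (hz : z ≠ 0) {M : Mat q} (hM : IsUnit M) :
    (z • M)⁻¹ = z⁻¹ • M⁻¹ := by
  have := Matrix.inv_smul' M (Units.mk0 z hz) ((Matrix.isUnit_iff_isUnit_det _).1 hM)
  simpa [Units.smul_def] using this

theorem inv_smul_inv_mul (hz : z ≠ 0) {M N : Mat q} (hM : IsUnit M) (hN : IsUnit N) :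
    (z • (M⁻¹ * N))⁻¹ = z⁻¹ • (N⁻¹ * M) := by
  have hM' := (Matrix.isUnit_iff_isUnit_det _).1 hM
  rw [inv_smul_of_ne_zero hz ((Matrix.isUnit_nonsing_inv_iff.2 hM).mul hN), Matrix.mul_inv_rev,
    Matrix.nonsing_inv_nonsing_inv _ hM']

theorem add_smul_inv_mul (hr : ∀ k, r (k + 2) = r (k + 1) * b k + z⁻¹ • r k) {k : ℕ}
    (hk : IsUnit (r (k + 1))) : b k + z⁻¹ • ((r (k + 1))⁻¹ * r k) = (r (k + 1))⁻¹ * r (k + 2) := by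
  rw [hr, mul_add, Matrix.nonsing_inv_mul_cancel_left _ _ ((Matrix.isUnit_iff_isUnit_det _).1 hk),
    mul_smul_comm]

theorem add_wOdd_inv (hz : z ≠ 0) (hr : ∀ k, r (k + 2) = r (k + 1) * b k + z⁻¹ • r k) {k : ℕ}
    (h₁ : IsUnit (r (k + 1))) (h₂ : IsUnit (r (k + 2))) :
    b (k + 1) + (z • ((r (k + 1))⁻¹ * r (k + 2)))⁻¹ = (r (k + 2))⁻¹ * r (k + 3) := by
  rw [inv_smul_inv_mul hz h₁ h₂, add_smul_inv_mul hr h₂]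

theorem smul_add_inv (hz : z ≠ 0) (hr : ∀ k, r (k + 2) = r (k + 1) * b k + z⁻¹ • r k) {k : ℕ}
    (h₁ : IsUnit (r k)) (h₂ : IsUnit (r (k + 1))) :
    z • b k + ((r k)⁻¹ * r (k + 1))⁻¹ = z • ((r (k + 1))⁻¹ * r (k + 2)) := by
  rw [Matrix.mul_inv_rev, Matrix.nonsing_inv_nonsing_inv _ ((Matrix.isUnit_iff_isUnit_det _).1 h₁),
    ← add_smul_inv_mul hr h₂, smul_add, smul_smul, mul_inv_cancel₀ hz, one_smul]

/-- The innermost level of the continued fraction. -/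
theorem add_smul_inv_eq (hr : ∀ k, r (k + 2) = r (k + 1) * b k + z⁻¹ • r k)
    (h0 : r 0 = 0) (h1 : r 1 = 1) (hm : 0 < m)
    (hc : ∀ j ≤ m, b (2 * j) = c (m - j)) (hd : ∀ j < m, b (2 * j + 1) = d (m - 1 - j))
    (h2 : IsUnit (r 2)) : d (m - 1) + z⁻¹ • (c m)⁻¹ = (r 2)⁻¹ * r 3 := by
  have hb0 : b 0 = c m := hc 0 (by omega)
  have hb1 : b 1 = d (m - 1) := hd 0 hm
  have hr2 : r 2 = c m := by rw [hr, h0, h1, hb0]; simp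
  rw [← add_smul_inv_mul hr h2, h1, hb1, mul_one, hr2]

/-- The tails of the continued fraction as quotients of successive denominators. -/
theorem wOdd_eq (hz : z ≠ 0) (hr : ∀ k, r (k + 2) = r (k + 1) * b k + z⁻¹ • r k)
    (h0 : r 0 = 0) (h1 : r 1 = 1)
    (hc : ∀ j ≤ m, b (2 * j) = c (m - j)) (hd : ∀ j < m, b (2 * j + 1) = d (m - 1 - j))
    {j : ℕ} (hj : j < m) (hu : ∀ k < 2 * j + 3, IsUnit (r (k + 1))) :
    wOdd q m c d j z = z • ((r (2 * j + 3))⁻¹ * r (2 * j + 4)) := by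
  induction j with
  | zero =>
    have hb2 : b 2 = c (m - 1) := hc 1 (by omega)
    rw [wOdd, add_smul_inv_eq hr h0 h1 hj hc hd (hu 1 (by omega)), ← hb2,
      smul_add_inv hz hr (hu 1 (by omega)) (hu 2 (by omega))]
  | succ j ih =>
    have hbc : b (2 * j + 4) = c (m - 2 - j) := by
      rw [show 2 * j + 4 = 2 * (j + 2) by ring, hc _ (by omega)]
      congr 1
      omega
    have hbd : b (2 * j + 3) = d (m - 2 - j) := by
      rw [show 2 * j + 3 = 2 * (j + 1) + 1 by ring, hd _ hj]
      congr 1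
      omega
    rw [wOdd, ih (by omega) fun k hk => hu k (by omega), ← hbc, ← hbd,
      add_wOdd_inv hz hr (hu (2 * j + 2) (by omega)) (hu (2 * j + 3) (by omega)),
      smul_add_inv hz hr (hu (2 * j + 3) (by omega)) (hu (2 * j + 4) (by omega))]
    rfl

theorem add_wOdd_inv_eq (hz : z ≠ 0) (hr : ∀ k, r (k + 2) = r (k + 1) * b k + z⁻¹ • r k)
    (h0 : r 0 = 0) (h1 : r 1 = 1)
    (hc : ∀ j ≤ m, b (2 * j) = c (m - j)) (hd : ∀ j < m, b (2 * j + 1) = d (m - 1 - j))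
    {j : ℕ} (hj : j + 1 < m) (hu : ∀ k < 2 * j + 4, IsUnit (r (k + 1))) :
    d (m - 2 - j) + (wOdd q m c d j z)⁻¹ = (r (2 * j + 4))⁻¹ * r (2 * j + 5) := by
  have hbd : b (2 * j + 3) = d (m - 2 - j) := by
    rw [show 2 * j + 3 = 2 * (j + 1) + 1 by ring, hd _ hj]
    congr 1
    omega
  rw [wOdd_eq hz hr h0 h1 hc hd (by omega) fun k hk => hu k (by omega), ← hbd,
    add_wOdd_inv hz hr (hu (2 * j + 2) (by omega)) (hu (2 * j + 3) (by omega))]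

theorem isUnit_of_isUnit_inv_mul {M N : Mat q} (hM : IsUnit M) (h : IsUnit (M⁻¹ * N)) :
    IsUnit N := by
  have := hM.mul h
  rwa [Matrix.mul_nonsing_inv_cancel_left _ _ ((Matrix.isUnit_iff_isUnit_det _).1 hM)] at this

theorem isUnit_of_isUnit_smul (hz : z ≠ 0) {M : Mat q} (h : IsUnit (z • M)) : IsUnit M := by
  rw [← isUnit_smul_iff (Units.mk0 z hz)]
  exact h

/-- If all inverses in the continued fraction exist, all denominators are invertible. -/
theorem isUnit_of_isUnit_wOdd (hz : z ≠ 0) (hr : ∀ k, r (k + 2) = r (k + 1) * b k + z⁻¹ • r k)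
    (h0 : r 0 = 0) (h1 : r 1 = 1)
    (hc : ∀ j ≤ m, b (2 * j) = c (m - j)) (hd : ∀ j < m, b (2 * j + 1) = d (m - 1 - j))
    (hcm : IsUnit (c m)) (hu₀ : IsUnit (d (m - 1) + z⁻¹ • (c m)⁻¹))
    (hu₁ : ∀ j < m, IsUnit (wOdd q m c d j z))
    (hu₂ : ∀ j, j + 1 < m → IsUnit (d (m - 2 - j) + (wOdd q m c d j z)⁻¹))
    {j : ℕ} (hj : j < m) : ∀ k < 2 * j + 4, IsUnit (r (k + 1)) := by
  have extend : ∀ {n : ℕ}, (∀ k < n, IsUnit (r (k + 1))) → IsUnit (r (n + 1)) →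
      ∀ k < n + 1, IsUnit (r (k + 1)) := fun h h' k hk => by
    rcases Nat.lt_succ_iff_lt_or_eq.1 hk with hk | rfl
    exacts [h k hk, h']
  have last : ∀ {j : ℕ}, j < m → (∀ k < 2 * j + 3, IsUnit (r (k + 1))) →
      ∀ k < 2 * j + 4, IsUnit (r (k + 1)) := fun {j} hj h => by
    refine extend h (isUnit_of_isUnit_inv_mul (h (2 * j + 2) (by omega))
      (isUnit_of_isUnit_smul hz ?_))
    rw [← wOdd_eq hz hr h0 h1 hc hd hj h]
    exact hu₁ j hj
  induction j with
  | zero =>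
    have hr2 : IsUnit (r 2) := by
      rw [hr, h0, h1, show b 0 = c m from hc 0 (by omega)]
      simpa using hcm
    have hr3 : IsUnit (r 3) := by
      refine isUnit_of_isUnit_inv_mul hr2 ?_
      rwa [← add_smul_inv_eq hr h0 h1 hj hc hd hr2]
    refine last hj fun k hk => ?_
    interval_cases k
    · rw [h1]; exact isUnit_one
    · exact hr2
    · exact hr3
  | succ j ih =>
    have h := ih (by omega)
    refine last hj (extend h (isUnit_of_isUnit_inv_mul (h (2 * j + 3) (by omega)) ?_))
    change IsUnit ((r (2 * j + 4))⁻¹ * r (2 * j + 5))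
    rw [← add_wOdd_inv_eq hz hr h0 h1 hc hd hj h]
    exact hu₂ j hj

theorem mul_inv_smul_eq_iff (hz : z ≠ 0) {h g M N : Mat q} (hg : IsUnit g) (hM : IsUnit M)
    (hN : IsUnit N) : h * (z • g)⁻¹ = (z • (M⁻¹ * N))⁻¹ ↔ N * h = M * g := by
  rw [inv_smul_inv_mul hz hM hN, inv_smul_of_ne_zero hz hg, mul_smul_comm]
  have hg' := (Matrix.isUnit_iff_isUnit_det _).1 hg
  have hN' := (Matrix.isUnit_iff_isUnit_det _).1 hN
  constructor
  · intro e
    have e' := smul_right_injective (Mat q) (inv_ne_zero hz) e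
    have := congrArg (fun Z => N * Z * g) e'
    simpa [mul_assoc, Matrix.nonsing_inv_mul _ hg',
      Matrix.mul_nonsing_inv_cancel_left _ _ hN'] using this
  · intro e
    congr 1
    have := congrArg (fun Z => N⁻¹ * Z * g⁻¹) e
    simpa [mul_assoc, Matrix.mul_nonsing_inv _ hg',
      Matrix.nonsing_inv_mul_cancel_left _ _ hN'] using this

end ContinuedFraction

section Markov

open Polynomial

variable {q m : ℕ}

/-- The polynomial `∑ j ≤ N, (-x)^j c_j`. -/
def altPoly (N : ℕ) (c : ℕ → Mat q) : (Mat q)[X] :=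
  ∑ j ∈ Finset.range (N + 1), X ^ j * C ((-1 : ℂ) ^ j • c j)

theorem coeff_altPoly (N k : ℕ) (c : ℕ → Mat q) :
    (altPoly N c).coeff k = if k ≤ N then (-1 : ℂ) ^ k • c k else 0 := by
  simp only [altPoly, finsetSum_coeff, X_pow_mul_C, coeff_C_mul_X_pow]
  rw [Finset.sum_ite_eq]
  simp

theorem natDegree_altPoly_le (N : ℕ) (c : ℕ → Mat q) : (altPoly N c).natDegree ≤ N := by
  refine natDegree_le_iff_coeff_eq_zero.2 fun k hk => ?_
  rw [coeff_altPoly, if_neg (by omega)]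

theorem sum_pow_smul_eq_scalarEval_altPoly (N : ℕ) (c : ℕ → Mat q) {z : ℂ} (hz : z ≠ 0) :
    ∑ j ∈ Finset.range (N + 1), z ^ (N - j) • c j =
      z ^ N • scalarEval (-z⁻¹) (altPoly N c) := by
  rw [altPoly, map_sum, Finset.smul_sum]
  refine Finset.sum_congr rfl fun j hj => ?_
  have hj' : j ≤ N := Nat.lt_succ_iff.1 (Finset.mem_range.1 hj)
  rw [scalarEval_X_pow_mul, scalarEval_C, smul_smul, smul_smul, mul_assoc, ← mul_pow, neg_mul_neg,
    mul_one, pow_sub₀ _ hz hj', inv_pow]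

theorem isUnit_scalarEval_zero_altPoly (N : ℕ) {c : ℕ → Mat q} (h : IsUnit (c 0)) :
    IsUnit (scalarEval 0 (altPoly N c)) := by
  rw [scalarEval_eq_sum, Finset.sum_range_succ']
  simpa [coeff_altPoly] using h

/-- The Markov parameters are the moments of `h(z) (z g(z))⁻¹`. -/
theorem MarkovOdd.truncEq {A s : ℕ → Mat q} (hM : MarkovOdd q m A s) :
    TruncEq (2 * m + 1)
      (PowerSeries.mk s * ((altPoly m fun j => A (2 * j) : (Mat q)[X]) : PowerSeries (Mat q)))
      ((altPoly m fun j => A (2 * j + 1) : (Mat q)[X]) : PowerSeries (Mat q)) := by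
  obtain ⟨B, hB⟩ := hM
  set g := altPoly m fun j => A (2 * j) with hg
  set h := altPoly m fun j => A (2 * j + 1) with hh
  set S := altPoly (2 * m) fun j => (-1 : ℂ) ^ j • s j with hS
  set E := altPoly m fun j => B (m - j) with hE
  have key : S * g = h + X ^ (2 * m + 1) * E := by
    refine eq_of_infinite_scalarEval ((Set.finite_singleton (0 : ℂ)).infinite_compl.mono ?_)
    intro x hx
    have hx0 : x ≠ 0 := hx
    set z := -x⁻¹ with hzx
    have hz : z ≠ 0 := neg_ne_zero.2 (inv_ne_zero hx0)
    have hxz : -z⁻¹ = x := by rw [hzx, inv_neg, inv_inv, neg_neg]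
    have h1 : hOdd q m A z = z ^ m • scalarEval x h := by
      rw [hOdd, sum_pow_smul_eq_scalarEval_altPoly _ _ hz, hxz]
    have h2 : gOdd q m A z = z ^ m • scalarEval x g := by
      rw [gOdd, sum_pow_smul_eq_scalarEval_altPoly m (fun j => A (2 * j)) hz, hxz]
    have h3 : ∑ j ∈ Finset.range (2 * m + 1), ((-1 : ℂ) ^ j * z ^ (2 * m - j)) • s j =
        z ^ (2 * m) • scalarEval x S := by
      rw [hS, ← hxz, ← sum_pow_smul_eq_scalarEval_altPoly (2 * m) _ hz]
      exact Finset.sum_congr rfl fun j _ => by rw [smul_smul, mul_comm]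
    have h4 : ∑ k ∈ Finset.range (m + 1), z ^ k • B k = z ^ m • scalarEval x E := by
      rw [hE, ← hxz, ← sum_pow_smul_eq_scalarEval_altPoly m _ hz, ← Finset.sum_range_reflect]
      exact Finset.sum_congr rfl fun j _ => by simp
    have e := hB z
    rw [h1, h2, h3, h4] at e
    change scalarEval x (S * g) = scalarEval x (h + X ^ (2 * m + 1) * E)
    rw [map_add, scalarEval_X_pow_mul, map_mul]
    rw [smul_smul, smul_smul, smul_mul_smul_comm, ← pow_add, ← pow_succ', ← pow_add] at e
    have e' := congrArg (fun M => x ^ (3 * m + 1) • M) e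
    have p1 : x ^ (3 * m + 1) * z ^ (2 * m + 1 + m) = (-1) ^ (3 * m + 1) := by
      rw [show 2 * m + 1 + m = 3 * m + 1 by ring, ← mul_pow, hzx, mul_neg, mul_inv_cancel₀ hx0]
    have p2 : x ^ (3 * m + 1) * z ^ m = (-1) ^ m * x ^ (2 * m + 1) := by
      rw [show 3 * m + 1 = m + (2 * m + 1) by ring, pow_add, mul_right_comm, ← mul_pow, hzx,
        mul_neg, mul_inv_cancel₀ hx0]
    simp only [smul_sub, smul_smul] at e'
    rw [show 2 * m + (m + 1) = 2 * m + 1 + m by ring, p1, p2] at e'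
    have e'' := congrArg (fun M => (-1 : ℂ) ^ m • M) e'
    have p3 : (-1 : ℂ) ^ m * (-1) ^ (3 * m + 1) = -1 := by
      rw [← pow_add]
      exact Odd.neg_one_pow ⟨2 * m, by ring⟩
    have p4 : (-1 : ℂ) ^ m * ((-1) ^ m * x ^ (2 * m + 1)) = x ^ (2 * m + 1) := by
      rw [← mul_assoc, ← mul_pow]
      simp
    simp only [smul_sub, smul_smul] at e''
    rw [p3, p4] at e''
    rw [← e'']
    simp
  have hT : TruncEq (2 * m + 1) (PowerSeries.mk s) (S : PowerSeries (Mat q)) := by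
    intro k hk
    rw [PowerSeries.coeff_mk, Polynomial.coeff_coe, hS, coeff_altPoly, if_pos (by omega),
      smul_smul, ← mul_pow]
    simp
  refine (hT.mul_right _).trans fun k hk => ?_
  rw [← Polynomial.coe_mul, key, Polynomial.coeff_coe, Polynomial.coeff_coe, coeff_add,
    coeff_X_pow_mul', if_neg (by omega), add_zero]

end Markov

section Main

open Polynomial Topology Filter

variable {q m : ℕ}

/-- The partial denominators of the continued fraction, innermost first. -/
def mergeSeq (m : ℕ) (c d : ℕ → Mat q) (i : ℕ) : Mat q :=
  if i % 2 = 0 then c (m - i / 2) else d (m - 1 - i / 2)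

theorem mergeSeq_even (c d : ℕ → Mat q) (j : ℕ) : mergeSeq m c d (2 * j) = c (m - j) := by
  rw [mergeSeq, if_pos (by omega)]
  congr 1
  omega

theorem mergeSeq_odd (c d : ℕ → Mat q) (j : ℕ) :
    mergeSeq m c d (2 * j + 1) = d (m - 1 - j) := by
  rw [mergeSeq, if_neg (by omega)]
  congr 1
  omega

theorem posDef_mergeSeq {c d : ℕ → Mat q} (hc : ∀ k ≤ m, (c k).PosDef)
    (hd : ∀ k < m, (d k).PosDef) {i : ℕ} (hi : i < 2 * m + 1) : (mergeSeq m c d i).PosDef := by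
  unfold mergeSeq
  split_ifs
  · exact hc _ (by omega)
  · exact hd _ (by omega)

theorem scalarEval_convDen_neg_inv (b : ℕ → Mat q) (z : ℂ) (k : ℕ) :
    scalarEval (-z⁻¹) (convDen b (k + 2)) =
      scalarEval (-z⁻¹) (convDen b (k + 1)) * b k + z⁻¹ • scalarEval (-z⁻¹) (convDen b k) := by
  rw [scalarEval_convDen, neg_smul, sub_neg_eq_add]

theorem hOdd_eq (A : ℕ → Mat q) {z : ℂ} (hz : z ≠ 0) :
    hOdd q m A z = z ^ m • scalarEval (-z⁻¹) (altPoly m fun j => A (2 * j + 1)) :=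
  sum_pow_smul_eq_scalarEval_altPoly m (fun j => A (2 * j + 1)) hz

theorem gOdd_eq (A : ℕ → Mat q) {z : ℂ} (hz : z ≠ 0) :
    gOdd q m A z = z ^ m • scalarEval (-z⁻¹) (altPoly m fun j => A (2 * j)) :=
  sum_pow_smul_eq_scalarEval_altPoly m (fun j => A (2 * j)) hz

/-- The numerator identity implies the continued fraction representation. -/
theorem isHTMOdd_of_mul_eq_mul (hm : 1 ≤ m) {A b : ℕ → Mat q}
    (hb : ∀ j < 2 * m + 1, (b j).PosDef)
    (h : convDen b (2 * m + 2) * (altPoly m fun j => A (2 * j + 1)) =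
      convDen b (2 * m + 1) * (altPoly m fun j => A (2 * j))) :
    IsHTMOdd q m (hOdd q m A) (gOdd q m A) := by
  set c : ℕ → Mat q := fun k => b (2 * (m - k)) with hcdef
  set d : ℕ → Mat q := fun k => b (2 * (m - 1 - k) + 1) with hddef
  have hc : ∀ j ≤ m, b (2 * j) = c (m - j) := fun j hj => by
    simp only [hcdef, Nat.sub_sub_self hj]
  have hd : ∀ j < m, b (2 * j + 1) = d (m - 1 - j) := fun j hj => by
    simp only [hddef, Nat.sub_sub_self (show j ≤ m - 1 by omega)]
  refine ⟨c, d, fun k hk => hb _ (by omega), fun k hk => hb _ (by omega),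
    fun z hz hg hu₀ hu₁ hu₂ => ?_⟩
  simp only [← isUnit_iff_ne_zero, ← Matrix.isUnit_iff_isUnit_det] at hg hu₀ hu₁ hu₂
  have hr := scalarEval_convDen_neg_inv b z
  have h0 : scalarEval (-z⁻¹) (convDen b 0) = 0 := map_zero _
  have h1 : scalarEval (-z⁻¹) (convDen b 1) = 1 := map_one _
  have hcm : IsUnit (c m) := (hb _ (by omega)).isUnit
  have hm' : m - 1 < m := by omega
  set r : ℕ → Mat q := fun k => scalarEval (-z⁻¹) (convDen b k) with hrdef
  have hu := isUnit_of_isUnit_wOdd (r := r) hz hr h0 h1 hc hd hcm hu₀ hu₁ hu₂ hm'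
  rw [wOdd_eq (r := r) hz hr h0 h1 hc hd hm' fun k hk => hu k (by omega),
    mul_inv_smul_eq_iff hz hg (hu (2 * (m - 1) + 2) (by omega))
      (hu (2 * (m - 1) + 3) (by omega)), hOdd_eq A hz, gOdd_eq A hz, mul_smul_comm, mul_smul_comm,
    show 2 * (m - 1) + 4 = 2 * m + 2 by omega, show 2 * (m - 1) + 3 = 2 * m + 1 by omega]
  congr 1
  have := congrArg (scalarEval (-z⁻¹)) h
  rwa [map_mul, map_mul] at this

theorem eventually_isUnit_scalarEval {p : (Mat q)[X]} (h : IsUnit (scalarEval 0 p)) :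
    ∀ᶠ x in 𝓝 (0 : ℂ), IsUnit (scalarEval x p) := by
  have hcont : Continuous fun x => (scalarEval x p).det := (continuous_scalarEval p).matrix_det
  have h0 := ((Matrix.isUnit_iff_isUnit_det _).1 h).ne_zero
  filter_upwards [hcont.continuousAt.eventually_ne h0] with x hx
  exact (Matrix.isUnit_iff_isUnit_det _).2 hx.isUnit

/-- The continued fraction representation implies the numerator identity. -/
theorem IsHTMOdd.exists_mul_eq_mul (hm : 1 ≤ m) {A : ℕ → Mat q} (hA0 : IsUnit (A 0))
    (h : IsHTMOdd q m (hOdd q m A) (gOdd q m A)) :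
    ∃ b : ℕ → Mat q, (∀ j < 2 * m + 1, (b j).PosDef) ∧
      convDen b (2 * m + 2) * (altPoly m fun j => A (2 * j + 1)) =
        convDen b (2 * m + 1) * (altPoly m fun j => A (2 * j)) := by
  obtain ⟨c, d, hc, hd, h⟩ := h
  set b := mergeSeq m c d with hbdef
  have hbc : ∀ j ≤ m, b (2 * j) = c (m - j) := fun j _ => mergeSeq_even c d j
  have hbd : ∀ j < m, b (2 * j + 1) = d (m - 1 - j) := fun j _ => mergeSeq_odd c d j
  have hb : ∀ j < 2 * m + 1, (b j).PosDef := fun j hj => posDef_mergeSeq hc hd hj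
  refine ⟨b, hb, eq_of_infinite_scalarEval ?_⟩
  have hev : ∀ᶠ x in 𝓝 (0 : ℂ),
      (∀ k ∈ Finset.range (2 * m + 2), IsUnit (scalarEval x (convDen b (k + 1)))) ∧
        IsUnit (scalarEval x (altPoly m fun j => A (2 * j))) := by
    refine ((eventually_all_finset _).2 fun k hk => eventually_isUnit_scalarEval
      (isUnit_scalarEval_zero_convDen fun j hj => (hb j ?_).isUnit)).and
      (eventually_isUnit_scalarEval (isUnit_scalarEval_zero_altPoly m hA0))
    have := Finset.mem_range.1 hk
    omega
  refine ((infinite_of_mem_nhds 0 hev).sdiff (Set.finite_singleton 0)).mono ?_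
  rintro x ⟨⟨hu, hg⟩, hx⟩
  have hx0 : x ≠ 0 := hx
  obtain ⟨z, hz, rfl⟩ : ∃ z : ℂ, z ≠ 0 ∧ x = -z⁻¹ :=
    ⟨-x⁻¹, neg_ne_zero.2 (inv_ne_zero hx0), by rw [inv_neg, inv_inv, neg_neg]⟩
  have hr := scalarEval_convDen_neg_inv b z
  have h0 : scalarEval (-z⁻¹) (convDen b 0) = 0 := map_zero _
  have h1 : scalarEval (-z⁻¹) (convDen b 1) = 1 := map_one _
  have hm' : m - 1 < m := by omega
  have smul_unit : ∀ (w : ℂ) {M : Mat q}, w ≠ 0 → IsUnit M → IsUnit (w • M) :=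
    fun w M hw hM => (isUnit_smul_iff (Units.mk0 w hw) M).2 hM
  replace hu : ∀ k < 2 * m + 2, IsUnit (scalarEval (-z⁻¹) (convDen b (k + 1))) :=
    fun k hk => hu k (Finset.mem_range.2 hk)
  set r : ℕ → Mat q := fun k => scalarEval (-z⁻¹) (convDen b k) with hrdef
  have inv_mul_unit : ∀ k, k + 1 < 2 * m + 2 → IsUnit ((r (k + 1))⁻¹ * r (k + 2)) := fun k hk =>
    (Matrix.isUnit_nonsing_inv_iff.2 (hu k (by omega))).mul (hu (k + 1) hk)
  have hg' : IsUnit (gOdd q m A z) := by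
    rw [gOdd_eq A hz]
    exact smul_unit _ (pow_ne_zero _ hz) hg
  have key := h z hz ((Matrix.isUnit_iff_isUnit_det _).1 hg').ne_zero ?_ ?_ ?_
  · rw [wOdd_eq (r := r) hz hr h0 h1 hbc hbd hm' fun k hk => hu k (by omega),
      mul_inv_smul_eq_iff hz hg' (hu (2 * (m - 1) + 2) (by omega))
        (hu (2 * (m - 1) + 3) (by omega)), hOdd_eq A hz, gOdd_eq A hz, mul_smul_comm,
      mul_smul_comm, show 2 * (m - 1) + 4 = 2 * m + 2 by omega,
      show 2 * (m - 1) + 3 = 2 * m + 1 by omega] at key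
    rw [Set.mem_ofPred_eq, map_mul, map_mul]
    exact smul_right_injective (Mat q) (pow_ne_zero m hz) key
  · rw [← Matrix.isUnit_iff_isUnit_det,
      add_smul_inv_eq (r := r) hr h0 h1 hm hbc hbd (hu 1 (by omega))]
    exact inv_mul_unit 1 (by omega)
  · intro j hj
    rw [← Matrix.isUnit_iff_isUnit_det,
      wOdd_eq (r := r) hz hr h0 h1 hbc hbd hj fun k hk => hu k (by omega)]
    exact smul_unit _ hz (inv_mul_unit (2 * j + 2) (by omega))
  · intro j hj
    rw [← Matrix.isUnit_iff_isUnit_det,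
      add_wOdd_inv_eq (r := r) hz hr h0 h1 hbc hbd hj fun k hk => hu k (by omega)]
    exact inv_mul_unit (2 * j + 3) (by omega)

theorem stieltjesPos_mk_iff {s : ℕ → Mat q} (hherm : ∀ j ≤ 2 * m, (s j).IsHermitian) :
    StieltjesPos q (2 * m + 1) (PowerSeries.mk s) ↔
      (H1b q s (m + 1)).PosDef ∧ (H2b q s m).PosDef := by
  have hstar : TruncEq (2 * m + 1) (starSeries (PowerSeries.mk s)) (PowerSeries.mk s) :=
    fun k hk => by
      rw [coeff_starSeries, PowerSeries.coeff_mk]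
      exact hherm k (by omega)
  have h₁ : (2 * m + 1 + 1) / 2 = m + 1 := by omega
  have h₂ : (2 * m + 1) / 2 = m := by omega
  simp only [StieltjesPos, PowerSeries.coeff_mk]
  rw [h₁, h₂]
  exact and_iff_right hstar

end Main

theorem stmt_4 (q m : ℕ) (hq : 1 ≤ q) (hm : 1 ≤ m) (A s : ℕ → Mat q)
    (hA0 : (A 0).det ≠ 0) (hherm : ∀ j ≤ 2 * m, (s j).IsHermitian)
    (hM : MarkovOdd q m A s) :
    IsHTMOdd q m (hOdd q m A) (gOdd q m A) ↔
      (H1b q s (m + 1)).PosDef ∧ (H2b q s m).PosDef := by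
  have hA : IsUnit (A 0) := (Matrix.isUnit_iff_isUnit_det _).2 hA0.isUnit
  have hg := isUnit_coe_of_isUnit_scalarEval_zero
    (isUnit_scalarEval_zero_altPoly m (c := fun j => A (2 * j)) hA)
  have hT := hM.truncEq
  rw [← stieltjesPos_mk_iff hherm]
  constructor
  · intro h
    obtain ⟨b, hb, e⟩ := h.exists_mul_eq_mul hm hA
    obtain ⟨U, hU, eU⟩ := exists_stieltjesPos_of_posDef hb
    refine hU.congr (TruncEq.symm (TruncEq.of_mul_right hg (TruncEq.of_mul_left
      (isUnit_coe_of_isUnit_scalarEval_zero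
        (isUnit_scalarEval_zero_convDen fun j hj => (hb j hj).isUnit)) ?_)))
    rw [← mul_assoc _ U, eU, ← Polynomial.coe_mul, ← e, Polynomial.coe_mul]
    exact hT.mul_left _
  · intro h
    obtain ⟨b, hb, hbT⟩ := h.exists_posDef
    refine isHTMOdd_of_mul_eq_mul hm hb (Polynomial.ext fun k => ?_)
    by_cases hk : k < 2 * m + 1
    · have := ((hT.symm.mul_left _).trans
        (by rw [← mul_assoc]; exact hbT.mul_right _)) k hk
      rwa [← Polynomial.coe_mul, ← Polynomial.coe_mul, Polynomial.coeff_coe,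
        Polynomial.coeff_coe] at this
    · have hdeg := natDegree_convDen_le b m
      rw [Polynomial.coeff_eq_zero_of_natDegree_lt, Polynomial.coeff_eq_zero_of_natDegree_lt]
      · have := natDegree_altPoly_le m fun j => A (2 * j)
        exact Polynomial.natDegree_mul_le.trans_lt (by omega)
      · have := natDegree_altPoly_le m fun j => A (2 * j + 1)
        exact Polynomial.natDegree_mul_le.trans_lt (by omega)

end
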